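/- (Categorified product formula, equal case) Let m ≥ 2. Define f₁ := (−1)^m (t_m ⊗ t_m) ∘ Cu_m : ℂ → V^{⊗2m}, g₁ := ½ · Ca_m ∘ (t_m ⊗ t_m) : V^{⊗2m} → ℂ, f₂ := (−1)^m (t_m ⊗ t_m) ∘ d_{2m} ∘ (Cu₁ ⊗ Cu_{m−1}) : ℂ → V^{⊗2m}, and g₂ := ½ · (Ca₁ ⊗ Ca_{m−1}) ∘ d_{2m}⁻¹ ∘ (t_m ⊗ t_m) : V^{⊗2m} → ℂ. Then g₁ ∘ f₁ = id_ℂ, g₂ ∘ f₂ = id_ℂ, g₁ ∘ f₂ = 0, g₂ ∘ f₁ = 0, and f₁ ∘ g₁ + f₂ ∘ g₂ = e_{m,m}; i.e. the idempotent e_{m,m} decomposes as the sum of two orthogonal rank-one idempotents each isomorphic to id_ℂ. -/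

import Mathlib

open Matrix

noncomputable section

/-- Sign strings `ε ∈ {+,-}^m`; `true` encodes `+` and `false` encodes `-`. -/
abbrev Sgn (m : ℕ) := Fin m → Bool

/-- Endomorphisms of `V^{⊗m}` (`V = ℂ²`), as matrices indexed by sign strings. -/
abbrev Op (m : ℕ) := Matrix (Sgn m) (Sgn m) ℂ

/-- Linear maps `V^{⊗m} → V^{⊗n}`, as matrices (rows: target, columns: source). -/
abbrev Mor (m n : ℕ) := Matrix (Sgn n) (Sgn m) ℂ

/-- The basis vector `v_ε` of `V^{⊗m}`. -/
def bv {m : ℕ} (ε : Sgn m) : Sgn m → ℂ := fun δ => if δ = ε then 1 else 0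

/-- The coefficient of `cap` on `v_a ⊗ v_b`:
`cap (v₋ ⊗ v₊) = 1`, `cap (v₊ ⊗ v₋) = -1`, `cap (v₊ ⊗ v₊) = cap (v₋ ⊗ v₋) = 0`. -/
def capc (a b : Bool) : ℂ := if a then (if b then 0 else -1) else (if b then 1 else 0)

/-- The coefficient of `v_a ⊗ v_b` in `cup 1 = v₊ ⊗ v₋ - v₋ ⊗ v₊`. -/
def cupc (a b : Bool) : ℂ := if a then (if b then 0 else 1) else (if b then -1 else 0)

/-- The cap `V ⊗ V → ℂ`. -/
def capM : Mor 2 0 := Matrix.of fun _ ε => capc (ε 0) (ε 1)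

/-- The cup `ℂ → V ⊗ V`. -/
def cupM : Mor 0 2 := Matrix.of fun δ _ => cupc (δ 0) (δ 1)

/-- The tensor product of two linear maps. -/
def tensMor {a b c d : ℕ} (A : Mor a b) (B : Mor c d) : Mor (a + c) (b + d) :=
  Matrix.of fun δ ε =>
    A (fun i => δ (Fin.castAdd d i)) (fun i => ε (Fin.castAdd c i)) *
      B (fun j => δ (Fin.natAdd b j)) (fun j => ε (Fin.natAdd a j))

/-- The swap of the two tensor factors of `V ⊗ V`. -/
def swap2 : Op 2 := Matrix.of fun δ ε => if δ 0 = ε 1 ∧ δ 1 = ε 0 then 1 else 0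

/-- `id^{⊗p} ⊗ A ⊗ id^{⊗(m-p-2)}`: the operator `A` on two strands placed at the
(0-based) positions `p`, `p+1` among `m` strands. -/
def atPos (m p : ℕ) (A : Op 2) : Op m :=
  Matrix.of fun δ ε =>
    if h : p + 2 ≤ m then
      (if ∀ k : Fin m, k.val ≠ p → k.val ≠ p + 1 → δ k = ε k then 1 else 0) *
        A (fun i => δ ⟨p + i.val, Nat.lt_of_lt_of_le (Nat.add_lt_add_left i.isLt p) h⟩)
          (fun i => ε ⟨p + i.val, Nat.lt_of_lt_of_le (Nat.add_lt_add_left i.isLt p) h⟩)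
    else 0

/-- Cyclic rotation of sign strings: `(rotIdx δ) k = δ (k+1 mod m)`. -/
def rotIdx {m : ℕ} (δ : Sgn m) : Sgn m := fun k => δ ⟨(k.val + 1) % m, Nat.mod_lt _ k.pos⟩

/-- The rotation `d_m : V^{⊗m} → V^{⊗m}`, `d_m (v_ε ⊗ w) = i^{ε} (w ⊗ v_ε)`. -/
def dRot : (m : ℕ) → Op m
  | 0 => 1
  | (m + 1) =>
    Matrix.of fun δ' δ =>
      if δ' = rotIdx δ then (if δ 0 then Complex.I else -Complex.I) else 0

/-- The cap-cup generator `u_j` (`j` is 1-based, `1 ≤ j ≤ m-1`);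
`u_0 := d_m⁻¹ ∘ u_1 ∘ d_m` is the affine generator. -/
def uFull (m j : ℕ) : Op m :=
  if j = 0 then (dRot m)⁻¹ * atPos m 0 (cupM * capM) * dRot m
  else atPos m (j - 1) (cupM * capM)

/-- The extremal weight projectors `t_m`, defined by `t₁ = id`,
`t₂ = id + u₁/2 + u₀/2`, and `t_{m+1} = (t_m ⊗ id) ∘ σ_m ∘ (t_m ⊗ id)` for `m ≥ 2`
(with the convention `t₀ = 2·id`). -/
def tP : (m : ℕ) → Op m
  | 0 => (2 : ℂ) • 1
  | 1 => 1
  | 2 => 1 + (2⁻¹ : ℂ) • atPos 2 0 (cupM * capM) +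
      (2⁻¹ : ℂ) • ((dRot 2)⁻¹ * atPos 2 0 (cupM * capM) * dRot 2)
  | (m + 3) =>
    tensMor (tP (m + 2)) (1 : Op 1) * atPos (m + 3) (m + 1) swap2 *
      tensMor (tP (m + 2)) (1 : Op 1)

/-- `n` nested caps `Ca_n : V^{⊗2n} → ℂ`. -/
def CaM (n : ℕ) : Mor (n + n) 0 :=
  Matrix.of fun _ δ =>
    ∏ k : Fin n,
      capc (δ ⟨k.val, Nat.lt_of_lt_of_le k.isLt (Nat.le_add_right n n)⟩)
        (δ ⟨n + n - 1 - k.val,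
          Nat.lt_of_le_of_lt (Nat.sub_le _ _)
            (Nat.sub_lt (Nat.lt_of_lt_of_le k.pos (Nat.le_add_right n n)) Nat.one_pos)⟩)

/-- `n` nested cups `Cu_n : ℂ → V^{⊗2n}`. -/
def CuM (n : ℕ) : Mor 0 (n + n) :=
  Matrix.of fun δ _ =>
    ∏ k : Fin n,
      cupc (δ ⟨k.val, Nat.lt_of_lt_of_le k.isLt (Nat.le_add_right n n)⟩)
        (δ ⟨n + n - 1 - k.val,
          Nat.lt_of_le_of_lt (Nat.sub_le _ _)
            (Nat.sub_lt (Nat.lt_of_lt_of_le k.pos (Nat.le_add_right n n)) Nat.one_pos)⟩)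

/-- The canonical identification of sign strings induced by an equality of lengths. -/
def sgnCast {a b : ℕ} (h : a = b) : Sgn a ≃ Sgn b :=
  Equiv.arrowCongr (finCongr h) (Equiv.refl Bool)

/-- Reindexing of a linear map along equalities of the numbers of strands. -/
def rc {a b c d : ℕ} (h1 : a = b) (h2 : c = d) (A : Mor a c) : Mor b d :=
  Matrix.reindex (sgnCast h2) (sgnCast h1) A

/-- The idempotents `e_{m,n}`:
`e_{1,1} = -u₁/2 - d₂⁻¹ ∘ u₁ ∘ d₂ / 2` and
`e_{m,n} = -(t_m ⊗ t_n) ∘ u_m ∘ (t_m ⊗ t_n)` otherwise. -/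
def eP : (m n : ℕ) → Op (m + n)
  | 1, 1 =>
    (-(2⁻¹ : ℂ)) • atPos 2 0 (cupM * capM) +
      (-(2⁻¹ : ℂ)) • ((dRot 2)⁻¹ * atPos 2 0 (cupM * capM) * dRot 2)
  | m, n =>
    -(tensMor (tP m) (tP n) * atPos (m + n) (m - 1) (cupM * capM) * tensMor (tP m) (tP n))

/-- The coefficient of the rotation `d_m` on a basis vector starting with the sign `a`. -/
def rotCoeff (a : Bool) : ℂ := if a then Complex.I else -Complex.I

/-- A string is constant when all of its signs agree. -/
def IsConst {m : ℕ} (δ : Sgn m) : Prop := ∀ i j, δ i = δ j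

instance {m : ℕ} (δ : Sgn m) : Decidable (IsConst δ) := by unfold IsConst; infer_instance

/-- The string `a^m b^m`. -/
def blockStr (m : ℕ) (a b : Bool) : Sgn (m + m) := fun k => if k.val < m then a else b

/-- The string `b a^m b^(m-1)`, whose rotation is `a^m b^m`. -/
def preBlockStr (m : ℕ) (a b : Bool) : Sgn (m + m) :=
  fun k => if k.val = 0 then b else if k.val ≤ m then a else b

/-- The map `ℂ → V^{⊗2m}` with image spanned by `x v₊^m v₋^m + y v₋^m v₊^m`. -/
def blockCol (m : ℕ) (x y : ℂ) : Mor 0 (m + m) := Matrix.of fun δ _ =>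
  if δ = blockStr m true false then x else if δ = blockStr m false true then y else 0

/-- The functional on `V^{⊗2m}` with values `x`, `y` at `v₊^m v₋^m`, `v₋^m v₊^m`, and zero
at the other basis vectors. -/
def blockRow (m : ℕ) (x y : ℂ) : Mor (m + m) 0 := Matrix.of fun _ δ =>
  if δ = blockStr m true false then x else if δ = blockStr m false true then y else 0

lemma rotIdx_injective {m : ℕ} : Function.Injective (rotIdx (m := m)) := by
  intro δ ε h
  funext k
  have hk := k.isLt
  have := congrFun h ⟨(k.val + (m - 1)) % m, Nat.mod_lt _ k.pos⟩
  have e : ((k.val + (m - 1)) % m + 1) % m = k.val := by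
    rw [Nat.mod_add_mod, show k.val + (m - 1) + 1 = k.val + m by omega, Nat.add_mod_right,
      Nat.mod_eq_of_lt hk]
  simpa only [rotIdx, e] using this

lemma dRot_apply {m : ℕ} [NeZero m] (δ ε : Sgn m) :
    dRot m δ ε = if δ = rotIdx ε then rotCoeff (ε 0) else 0 := by
  cases m with
  | zero => exact absurd rfl (NeZero.ne 0)
  | succ n => rfl

lemma star_rotCoeff_mul (a : Bool) : star (rotCoeff a) * rotCoeff a = 1 := by
  cases a <;> simp [rotCoeff]

lemma dRot_inv (m : ℕ) [NeZero m] : (dRot m)⁻¹ = (dRot m)ᴴ := by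
  apply Matrix.inv_eq_left_inv
  ext ε ε'
  simp only [Matrix.mul_apply, Matrix.conjTranspose_apply, dRot_apply, mul_ite, mul_zero,
    Finset.sum_ite_eq', Finset.mem_univ, if_true, Matrix.one_apply]
  by_cases h : ε = ε'
  · subst h
    simpa using star_rotCoeff_mul (ε 0)
  · have : rotIdx ε' ≠ rotIdx ε := fun h' => h (rotIdx_injective h').symm
    simp [h, this]

lemma dRot_mul_apply {m : ℕ} [NeZero m] {ι : Type*} (A : Matrix (Sgn m) ι ℂ) (ε : Sgn m)
    (j : ι) : (dRot m * A) (rotIdx ε) j = rotCoeff (ε 0) * A ε j := by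
  simp [Matrix.mul_apply, dRot_apply, rotIdx_injective.eq_iff]

lemma mul_dRot_inv_apply {m : ℕ} [NeZero m] {ι : Type*} (A : Matrix ι (Sgn m) ℂ)
    (ε : Sgn m) (j : ι) :
    (A * (dRot m)⁻¹) j (rotIdx ε) = A j ε * star (rotCoeff (ε 0)) := by
  simp only [dRot_inv, Matrix.mul_apply, Matrix.conjTranspose_apply, dRot_apply,
    rotIdx_injective.eq_iff]
  rw [Finset.sum_eq_single ε] <;> simp +contextual [eq_comm]

lemma mul_dRot_apply {m : ℕ} [NeZero m] {ι : Type*} (A : Matrix ι (Sgn m) ℂ)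
    (ε : Sgn m) (j : ι) : (A * dRot m) j ε = A j (rotIdx ε) * rotCoeff (ε 0) := by
  simp [Matrix.mul_apply, dRot_apply]

lemma dRot_inv_mul_apply {m : ℕ} [NeZero m] {ι : Type*} (A : Matrix (Sgn m) ι ℂ)
    (ε : Sgn m) (j : ι) :
    ((dRot m)⁻¹ * A) ε j = star (rotCoeff (ε 0)) * A (rotIdx ε) j := by
  simp only [dRot_inv, Matrix.mul_apply, Matrix.conjTranspose_apply, dRot_apply]
  rw [Finset.sum_eq_single (rotIdx ε)] <;> simp +contextual

lemma cupM_mul_capM_apply (δ ε : Sgn 2) :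
    (cupM * capM) δ ε = cupc (δ 0) (δ 1) * capc (ε 0) (ε 1) := by
  simp [Matrix.mul_apply, cupM, capM]

lemma atPos_two (A : Op 2) : atPos 2 0 A = A := by
  ext δ ε
  simp [atPos]

lemma tP_two : tP 2 = Matrix.diagonal fun δ => if IsConst δ then 1 else 0 := by
  ext δ ε
  have hδ : δ = ![δ 0, δ 1] := by ext i; fin_cases i <;> rfl
  have hε : ε = ![ε 0, ε 1] := by ext i; fin_cases i <;> rfl
  generalize δ 0 = a, δ 1 = b at hδ
  generalize ε 0 = c, ε 1 = d at hε
  subst hδ hε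
  simp only [tP, atPos_two, Matrix.add_apply, Matrix.smul_apply, mul_dRot_apply,
    dRot_inv_mul_apply, cupM_mul_capM_apply, Matrix.diagonal_apply, Matrix.one_apply]
  cases a <;> cases b <;> cases c <;> cases d <;>
    simp [rotIdx, rotCoeff, cupc, capc, IsConst, Fin.forall_fin_two] <;> norm_num

lemma tP_eq_diagonal (m : ℕ) :
    tP (m + 2) = Matrix.diagonal fun δ => if IsConst δ then 1 else 0 := by
  induction m with
  | zero => exact tP_two
  | succ m ih =>
    have hT : tensMor (tP (m + 2)) (1 : Op 1) = Matrix.diagonal fun δ : Sgn (m + 2 + 1) =>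
        if IsConst (fun i => δ (Fin.castAdd 1 i)) then 1 else 0 := by
      ext δ ε
      have : δ = ε ↔ (fun i => δ (Fin.castAdd 1 i)) = (fun i => ε (Fin.castAdd 1 i)) ∧
          (fun i => δ (Fin.natAdd (m + 2) i)) = (fun i => ε (Fin.natAdd (m + 2) i)) := by
        simp only [funext_iff, Fin.forall_fin_add]
      simp only [tensMor, ih, Matrix.of_apply, Matrix.diagonal_apply, Matrix.one_apply, this]
      split_ifs <;> simp_all
    change tensMor (tP (m + 2)) (1 : Op 1) * atPos (m + 3) (m + 1) swap2 *
      tensMor (tP (m + 2)) (1 : Op 1) = _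
    rw [hT]
    ext δ ε
    rw [Matrix.mul_diagonal, Matrix.diagonal_mul, Matrix.diagonal_apply]
    have hS : atPos (m + 3) (m + 1) swap2 δ ε =
        if (∀ k : Fin (m + 3), k.val ≠ m + 1 → k.val ≠ m + 2 → δ k = ε k) ∧
          δ ⟨m + 1, by omega⟩ = ε ⟨m + 2, by omega⟩ ∧
          δ ⟨m + 2, by omega⟩ = ε ⟨m + 1, by omega⟩ then 1 else 0 := by
      simp only [atPos, swap2, Matrix.of_apply, dif_pos (show m + 1 + 2 ≤ m + 3 by omega),
        ite_and, ite_mul, one_mul, zero_mul]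
      rfl
    rw [hS]
    by_cases hδ : IsConst (fun i : Fin (m + 2) => δ (Fin.castAdd 1 i))
    · by_cases hε : IsConst (fun i : Fin (m + 2) => ε (Fin.castAdd 1 i))
      · have hδ' : ∀ k (hk : k < m + 2), δ ⟨k, by omega⟩ = δ 0 :=
          fun k hk => hδ ⟨k, hk⟩ 0
        have hε' : ∀ k (hk : k < m + 2), ε ⟨k, by omega⟩ = ε 0 :=
          fun k hk => hε ⟨k, hk⟩ 0
        rw [if_pos hδ, if_pos hε, one_mul, mul_one, ← ite_and]
        refine if_congr ⟨?_, ?_⟩ rfl rfl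
        · rintro ⟨h, h1, h2⟩
          have h0 : δ 0 = ε 0 := h 0 (by simp) (by simp)
          rw [hδ' _ (by omega)] at h1
          rw [hε' _ (by omega)] at h2
          have cδ : ∀ i, δ i = δ 0 := fun i => by
            by_cases hi : i.val < m + 2
            · exact hδ' i hi
            · have : i = ⟨m + 2, by omega⟩ := Fin.ext (by simp; omega)
              rw [this, h2, h0]
          have cε : ∀ i, ε i = ε 0 := fun i => by
            by_cases hi : i.val < m + 2
            · exact hε' i hi
            · have : i = ⟨m + 2, by omega⟩ := Fin.ext (by simp; omega)
              rw [this, ← h1, h0]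
          exact ⟨funext fun i => by rw [cδ, cε, h0], fun i j => by rw [cδ, cδ j]⟩
        · rintro ⟨rfl, hc⟩
          exact ⟨fun _ _ _ => rfl, hc _ _, hc _ _⟩
      · rw [if_neg hε, mul_zero]
        split_ifs with h hc
        · subst h; exact absurd (fun i j => hc _ _) hε
        all_goals rfl
    · rw [if_neg hδ, zero_mul, zero_mul]
      split_ifs with h hc
      · exact absurd (fun i j => hc _ _) hδ
      all_goals rfl

lemma exists_eq_blockStr_iff {m : ℕ} (hm : 0 < m) (δ : Sgn (m + m)) :
    (∃ a b, δ = blockStr m a b) ↔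
      IsConst (fun i => δ (Fin.castAdd m i)) ∧ IsConst (fun i => δ (Fin.natAdd m i)) := by
  constructor
  · rintro ⟨a, b, rfl⟩
    constructor <;> intro i j <;> simp [blockStr]
  · rintro ⟨h1, h2⟩
    refine ⟨δ (Fin.castAdd m ⟨0, hm⟩), δ (Fin.natAdd m ⟨0, hm⟩), ?_⟩
    rw [funext_iff, Fin.forall_fin_add]
    exact ⟨fun i => by simpa [blockStr] using h1 i ⟨0, hm⟩,
      fun i => by simpa [blockStr] using h2 i ⟨0, hm⟩⟩

open Classical in
lemma tensMor_tP {m : ℕ} (hm : 2 ≤ m) : tensMor (tP m) (tP m) =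
    Matrix.diagonal fun δ => if ∃ a b, δ = blockStr m a b then (1 : ℂ) else 0 := by
  obtain ⟨n, rfl⟩ := Nat.exists_eq_add_of_le' hm
  ext δ ε
  have : δ = ε ↔ (fun i => δ (Fin.castAdd (n + 2) i)) = (fun i => ε (Fin.castAdd (n + 2) i)) ∧
      (fun i => δ (Fin.natAdd (n + 2) i)) = (fun i => ε (Fin.natAdd (n + 2) i)) := by
    simp only [funext_iff, Fin.forall_fin_add]
  simp only [tensMor, tP_eq_diagonal, Matrix.of_apply, Matrix.diagonal_apply, this,
    exists_eq_blockStr_iff (show 0 < n + 2 by omega)]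
  split_ifs <;> simp_all

lemma blockStr_inj {m : ℕ} (hm : 0 < m) {a b c d : Bool} :
    blockStr m a b = blockStr m c d ↔ a = c ∧ b = d := by
  constructor
  · intro h
    have h1 := congrFun h ⟨0, by omega⟩
    have h2 := congrFun h ⟨m, by omega⟩
    simp only [blockStr, hm, if_true, lt_irrefl, if_false] at h1 h2
    exact ⟨h1, h2⟩
  · rintro ⟨rfl, rfl⟩; rfl

lemma tensMor_tP_mul {m : ℕ} (hm : 2 ≤ m) (A : Mor 0 (m + m))
    (h : ∀ a, A (blockStr m a a) default = 0) :
    tensMor (tP m) (tP m) * A = blockCol m (A (blockStr m true false) default)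
      (A (blockStr m false true) default) := by
  ext δ j
  obtain rfl := Subsingleton.elim j default
  simp only [tensMor_tP hm, Matrix.diagonal_mul, blockCol, Matrix.of_apply]
  split_ifs with hb h1 h2 h1 h2
  · rw [h1, one_mul]
  · rw [h2, one_mul]
  · obtain ⟨a, b, rfl⟩ := hb
    cases a <;> cases b <;> simp_all
  · exact absurd ⟨_, _, h1⟩ hb
  · exact absurd ⟨_, _, h2⟩ hb
  · rw [zero_mul]

lemma mul_tensMor_tP {m : ℕ} (hm : 2 ≤ m) (A : Mor (m + m) 0)
    (h : ∀ a, A default (blockStr m a a) = 0) :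
    A * tensMor (tP m) (tP m) = blockRow m (A default (blockStr m true false))
      (A default (blockStr m false true)) := by
  ext j δ
  obtain rfl := Subsingleton.elim j default
  simp only [tensMor_tP hm, Matrix.mul_diagonal, blockRow, Matrix.of_apply]
  split_ifs with hb h1 h2 h1 h2
  · rw [h1, mul_one]
  · rw [h2, mul_one]
  · obtain ⟨a, b, rfl⟩ := hb
    cases a <;> cases b <;> simp_all
  · exact absurd ⟨_, _, h1⟩ hb
  · exact absurd ⟨_, _, h2⟩ hb
  · rw [mul_zero]

lemma blockRow_mul_blockCol {m : ℕ} (hm : 0 < m) (x y z w : ℂ) :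
    blockRow m x y * blockCol m z w = (x * z + y * w) • (1 : Op 0) := by
  have hne : blockStr m false true ≠ blockStr m true false := by simp [blockStr_inj hm]
  ext i j
  obtain rfl := Subsingleton.elim i j
  simp only [Matrix.mul_apply, blockRow, blockCol, Matrix.of_apply, Matrix.smul_apply,
    Matrix.one_apply_eq, smul_eq_mul, mul_one]
  have : ∀ δ : Sgn (m + m),
      ((if δ = blockStr m true false then x else if δ = blockStr m false true then y else 0) *
        if δ = blockStr m true false then z else if δ = blockStr m false true then w else 0) =
      (if δ = blockStr m true false then x * z else 0) +
        if δ = blockStr m false true then y * w else 0 := by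
    intro δ
    split_ifs with h1 h2
    · exact absurd (h2.symm.trans h1) hne
    all_goals simp
  simp [this, Finset.sum_add_distrib]

lemma rotIdx_preBlockStr {m : ℕ} (a b : Bool) :
    rotIdx (preBlockStr m a b) = blockStr m a b := by
  funext k
  have hk := k.isLt
  simp only [rotIdx, preBlockStr, blockStr]
  by_cases h : k.val + 1 = m + m
  · simp only [h, Nat.mod_self, if_true, if_neg (show ¬ k.val < m by omega)]
  · simp only [Nat.mod_eq_of_lt (show k.val + 1 < m + m by omega), Nat.succ_ne_zero, if_false,
      Nat.succ_le_iff]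

lemma CaM_apply {n : ℕ} {δ : Sgn (n + n)} {a b : Bool} (j : Sgn 0)
    (h : ∀ k : Fin (n + n), δ k = if k.val < n then a else b) :
    CaM n j δ = capc a b ^ n := by
  simp only [CaM, Matrix.of_apply, h]
  rw [Finset.prod_congr rfl fun k _ => by
    rw [if_pos k.isLt, if_neg (show ¬ n + n - 1 - k.val < n by omega)]]
  simp

lemma CuM_apply {n : ℕ} {δ : Sgn (n + n)} {a b : Bool} (j : Sgn 0)
    (h : ∀ k : Fin (n + n), δ k = if k.val < n then a else b) :
    CuM n δ j = cupc a b ^ n := by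
  simp only [CuM, Matrix.of_apply, h]
  rw [Finset.prod_congr rfl fun k _ => by
    rw [if_pos k.isLt, if_neg (show ¬ n + n - 1 - k.val < n by omega)]]
  simp

lemma rc_tensMor_CaM_apply {m : ℕ} (h : 1 + 1 + (m - 1 + (m - 1)) = m + m) (a b : Bool)
    (j : Sgn 0) :
    (rc h rfl (tensMor (CaM 1) (CaM (m - 1))) : Mor (m + m) 0) j (preBlockStr m a b) =
      capc b a * capc a b ^ (m - 1) := by
  change CaM 1 _ (fun i => preBlockStr m a b (Fin.cast h (Fin.castAdd _ i))) *
    CaM (m - 1) _ (fun i => preBlockStr m a b (Fin.cast h (Fin.natAdd _ i))) = _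
  rw [CaM_apply (a := b) (b := a), CaM_apply (a := a) (b := b), pow_one]
  · intro k
    simp only [preBlockStr, Fin.val_cast, Fin.val_natAdd]
    split_ifs <;> first | rfl | omega
  · intro k
    simp only [preBlockStr, Fin.val_cast, Fin.val_castAdd]
    split_ifs <;> first | rfl | omega

lemma rc_tensMor_CuM_apply {m : ℕ} (h : 1 + 1 + (m - 1 + (m - 1)) = m + m) (a b : Bool)
    (j : Sgn 0) :
    (rc rfl h (tensMor (CuM 1) (CuM (m - 1))) : Mor 0 (m + m)) (preBlockStr m a b) j =
      cupc b a * cupc a b ^ (m - 1) := by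
  change CuM 1 (fun i => preBlockStr m a b (Fin.cast h (Fin.castAdd _ i))) _ *
    CuM (m - 1) (fun i => preBlockStr m a b (Fin.cast h (Fin.natAdd _ i))) _ = _
  rw [CuM_apply (a := b) (b := a), CuM_apply (a := a) (b := b), pow_one]
  · intro k
    simp only [preBlockStr, Fin.val_cast, Fin.val_natAdd]
    split_ifs <;> first | rfl | omega
  · intro k
    simp only [preBlockStr, Fin.val_cast, Fin.val_castAdd]
    split_ifs <;> first | rfl | omega

lemma tensMor_tP_mul_CuM {m : ℕ} (hm : 2 ≤ m) :
    tensMor (tP m) (tP m) * CuM m = blockCol m 1 ((-1) ^ m) := by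
  have h (a b : Bool) : CuM m (blockStr m a b) default = cupc a b ^ m :=
    CuM_apply _ fun _ => rfl
  rw [tensMor_tP_mul hm _ fun a => by
    rw [h]; cases a <;> simp [cupc, show m ≠ 0 by omega], h, h]
  simp [cupc]

lemma CaM_mul_tensMor_tP {m : ℕ} (hm : 2 ≤ m) :
    CaM m * tensMor (tP m) (tP m) = blockRow m ((-1) ^ m) 1 := by
  have h (a b : Bool) : CaM m default (blockStr m a b) = capc a b ^ m :=
    CaM_apply _ fun _ => rfl
  rw [mul_tensMor_tP hm _ fun a => by
    rw [h]; cases a <;> simp [capc, show m ≠ 0 by omega], h, h]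
  simp [capc]

lemma tensMor_tP_mul_dRot_mul {m : ℕ} (hm : 2 ≤ m)
    (h : 1 + 1 + (m - 1 + (m - 1)) = m + m) :
    tensMor (tP m) (tP m) * dRot (m + m) *
        (rc rfl h (tensMor (CuM 1) (CuM (m - 1))) : Mor 0 (m + m)) =
      blockCol m Complex.I (Complex.I * (-1) ^ (m - 1)) := by
  have : NeZero (m + m) := ⟨by omega⟩
  have hv (a b : Bool) : (dRot (m + m) *
      (rc rfl h (tensMor (CuM 1) (CuM (m - 1))) : Mor 0 (m + m))) (blockStr m a b) default =
      rotCoeff b * (cupc b a * cupc a b ^ (m - 1)) := by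
    rw [← rotIdx_preBlockStr, dRot_mul_apply, rc_tensMor_CuM_apply]
    simp [preBlockStr]
  rw [Matrix.mul_assoc, tensMor_tP_mul hm _ fun a => by
    rw [hv]; cases a <;> simp [cupc], hv, hv]
  simp [cupc, rotCoeff]

lemma mul_dRot_inv_mul_tensMor_tP {m : ℕ} (hm : 2 ≤ m)
    (h : 1 + 1 + (m - 1 + (m - 1)) = m + m) :
    (rc h rfl (tensMor (CaM 1) (CaM (m - 1))) : Mor (m + m) 0) * (dRot (m + m))⁻¹ *
        tensMor (tP m) (tP m) =
      blockRow m (Complex.I * (-1) ^ (m - 1)) Complex.I := by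
  have : NeZero (m + m) := ⟨by omega⟩
  have hv (a b : Bool) : ((rc h rfl (tensMor (CaM 1) (CaM (m - 1))) : Mor (m + m) 0) *
      (dRot (m + m))⁻¹) default (blockStr m a b) =
      capc b a * capc a b ^ (m - 1) * star (rotCoeff b) := by
    rw [← rotIdx_preBlockStr, mul_dRot_inv_apply, rc_tensMor_CaM_apply]
    simp [preBlockStr]
  rw [mul_tensMor_tP hm _ fun a => by
    rw [hv]; cases a <;> simp [capc], hv, hv]
  simp [capc, rotCoeff, mul_comm]

lemma eP_self {m : ℕ} (hm : 2 ≤ m) : eP m m = Matrix.diagonal fun δ =>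
    if δ = blockStr m true false ∨ δ = blockStr m false true then (1 : ℂ) else 0 := by
  have he : eP m m = -(tensMor (tP m) (tP m) * atPos (m + m) (m - 1) (cupM * capM) *
      tensMor (tP m) (tP m)) := by
    unfold eP
    split
    · omega
    · rfl
  rw [he, tensMor_tP hm]
  ext δ ε
  rw [Matrix.neg_apply, Matrix.mul_diagonal, Matrix.diagonal_mul, Matrix.diagonal_apply]
  by_cases hδ : ∃ a b, δ = blockStr m a b
  · by_cases hε : ∃ a b, ε = blockStr m a b
    · rw [if_pos hδ, if_pos hε, one_mul, mul_one]
      obtain ⟨a, b, rfl⟩ := hδ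
      obtain ⟨c, d, rfl⟩ := hε
      have hu : atPos (m + m) (m - 1) (cupM * capM) (blockStr m a b) (blockStr m c d) =
          if a = c ∧ b = d then cupc a b * capc a b else 0 := by
        have h1 : (∀ k : Fin (m + m), k.val ≠ m - 1 → k.val ≠ m - 1 + 1 →
            blockStr m a b k = blockStr m c d k) ↔ a = c ∧ b = d := by
          constructor
          · intro h
            have h1 := h ⟨0, by omega⟩ (by simp; omega) (by simp)
            have h2 := h ⟨m + 1, by omega⟩ (by simp; omega) (by simp; omega)
            simpa [blockStr, show 0 < m by omega] using And.intro h1 h2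
          · rintro ⟨rfl, rfl⟩ _ _ _
            rfl
        simp only [atPos, Matrix.of_apply, dif_pos (show m - 1 + 2 ≤ m + m by omega), h1,
          cupM_mul_capM_apply, ite_mul, one_mul, zero_mul]
        refine if_ctx_congr Iff.rfl ?_ fun _ => rfl
        rintro ⟨rfl, rfl⟩
        simp [blockStr, show m - 1 < m by omega, show ¬ m - 1 + 1 < m by omega]
      rw [hu]
      simp only [blockStr_inj (show 0 < m by omega)]
      cases a <;> cases b <;> cases c <;> cases d <;> simp [cupc, capc]
    · rw [if_neg hε, mul_zero, neg_zero]
      split_ifs with h h'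
      · subst h; exact absurd (h'.elim (fun h => ⟨_, _, h⟩) fun h => ⟨_, _, h⟩) hε
      all_goals rfl
  · rw [if_neg hδ, zero_mul, zero_mul, neg_zero]
    split_ifs with h h'
    · exact absurd (h'.elim (fun h => ⟨_, _, h⟩) fun h => ⟨_, _, h⟩) hδ
    all_goals rfl

/-- Categorified product formula, equal case: for `m ≥ 2`,
the idempotent `e_{m,m}` decomposes as the sum of two orthogonal rank-one
idempotents, each isomorphic to `id_ℂ`. -/
theorem product_formula_equal (m : ℕ) (hm : 2 ≤ m) :
    ((2⁻¹ : ℂ) • (CaM m * tensMor (tP m) (tP m))) *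
      ((-1 : ℂ) ^ m • (tensMor (tP m) (tP m) * CuM m)) = 1 ∧
    ((2⁻¹ : ℂ) • ((rc (by omega) rfl (tensMor (CaM 1) (CaM (m - 1))) : Mor (m + m) 0) *
        (dRot (m + m))⁻¹ * tensMor (tP m) (tP m))) *
      ((-1 : ℂ) ^ m • (tensMor (tP m) (tP m) * dRot (m + m) *
        (rc rfl (by omega) (tensMor (CuM 1) (CuM (m - 1))) : Mor 0 (m + m)))) = 1 ∧
    ((2⁻¹ : ℂ) • (CaM m * tensMor (tP m) (tP m))) *
      ((-1 : ℂ) ^ m • (tensMor (tP m) (tP m) * dRot (m + m) *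
        (rc rfl (by omega) (tensMor (CuM 1) (CuM (m - 1))) : Mor 0 (m + m)))) = 0 ∧
    ((2⁻¹ : ℂ) • ((rc (by omega) rfl (tensMor (CaM 1) (CaM (m - 1))) : Mor (m + m) 0) *
        (dRot (m + m))⁻¹ * tensMor (tP m) (tP m))) *
      ((-1 : ℂ) ^ m • (tensMor (tP m) (tP m) * CuM m)) = 0 ∧
    ((-1 : ℂ) ^ m • (tensMor (tP m) (tP m) * CuM m)) *
        ((2⁻¹ : ℂ) • (CaM m * tensMor (tP m) (tP m))) +
      ((-1 : ℂ) ^ m • (tensMor (tP m) (tP m) * dRot (m + m) *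
        (rc rfl (by omega) (tensMor (CuM 1) (CuM (m - 1))) : Mor 0 (m + m)))) *
        ((2⁻¹ : ℂ) • ((rc (by omega) rfl (tensMor (CaM 1) (CaM (m - 1))) : Mor (m + m) 0) *
          (dRot (m + m))⁻¹ * tensMor (tP m) (tP m))) = eP m m := by
  have h : 1 + 1 + (m - 1 + (m - 1)) = m + m := by omega
  have hm0 : 0 < m := by omega
  have hne : blockStr m false true ≠ blockStr m true false := by simp [blockStr_inj hm0]
  have hsq : (-1 : ℂ) ^ m * (-1) ^ m = 1 := by rw [← mul_pow]; simp
  have hpred : (-1 : ℂ) ^ (m - 1) = -(-1) ^ m := by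
    obtain ⟨n, rfl⟩ := Nat.exists_eq_add_of_le' hm0
    simp [pow_succ]
  have hI := Complex.I_mul_I
  rw [tensMor_tP_mul_CuM hm, CaM_mul_tensMor_tP hm, tensMor_tP_mul_dRot_mul hm h,
    mul_dRot_inv_mul_tensMor_tP hm h, eP_self hm, hpred]
  generalize (-1 : ℂ) ^ m = s at hsq
  simp only [Matrix.smul_mul, Matrix.mul_smul, blockRow_mul_blockCol hm0, smul_smul]
  refine ⟨?_, ?_, ?_, ?_, ?_⟩
  · rw [show s * (2⁻¹ * (s * 1 + 1 * s)) = 1 by linear_combination hsq, one_smul]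
  · rw [show s * (2⁻¹ * (Complex.I * -s * Complex.I + Complex.I * (Complex.I * -s))) = 1 by
      linear_combination (-s * s) * hI + hsq, one_smul]
  · rw [show s * (2⁻¹ * (s * Complex.I + 1 * (Complex.I * -s))) = 0 by ring, zero_smul]
  · rw [show s * (2⁻¹ * (Complex.I * -s * 1 + Complex.I * s)) = 0 by ring, zero_smul]
  · ext δ ε
    simp only [Matrix.add_apply, Matrix.smul_apply, Matrix.mul_apply, blockCol, blockRow,
      Matrix.of_apply, Finset.univ_unique, Finset.sum_singleton, Matrix.diagonal_apply,
      smul_eq_mul]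
    by_cases h1 : δ = blockStr m true false
    · by_cases h2 : ε = blockStr m true false
      · simp only [h1, h2, if_true, true_or]
        linear_combination hsq - s * s / 2 * hI
      · by_cases h3 : ε = blockStr m false true
        · simp only [h1, h3, hne, hne.symm, if_true, if_false]
          linear_combination s / 2 * hI
        · simp [h1, h2, h3, Ne.symm h2]
    · by_cases h1' : δ = blockStr m false true
      · by_cases h2 : ε = blockStr m true false
        · simp only [h1', h2, hne, if_true, if_false]
          linear_combination s * s * s / 2 * hI
        · by_cases h3 : ε = blockStr m false true
          · simp only [h1', h3, hne, if_true, if_false, or_true]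
            linear_combination hsq - s * s / 2 * hI
          · simp [h1', h2, h3, Ne.symm h3]
      · simp [h1, h1']
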